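/- arXiv:1609.08322 — 6 statements merged into one kernel-verified Lean document; each statement's English description precedes it below -/
import Mathlib

section
/- Let p and q be distinct primes and let D be a group that is an internal semidirect product D = A ⋊ B of a cyclic p-group A (normal in D) and a subgroup B of order q, with [A, B] ≠ 1. Suppose X and Y are locally finite groups and D is a section of the direct product X × Y. Then D is a section of X or D is a section of Y. -/
/-- `D` is a section of `X` if `D` is a homomorphic image of a subgroup of `X`. -/
def IsSection (D X : Type*) [Group D] [Group X] : Prop :=
  ∃ (K : Subgroup X) (f : K →* D), Function.Surjective f

/-- A group is locally finite if every finitely generated subgroup is finite. -/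
def IsLocallyFinite (X : Type*) [Group X] : Prop :=
  ∀ S : Subgroup X, S.FG → Finite S

/-- In a finite nilpotent group, a cyclic subgroup that supplements the commutator subgroup is
the whole group. -/
theorem zpowers_eq_top_of_sup_commutator_eq_top {P : Type*} [Group P] [Finite P]
    [Group.IsNilpotent P] {v : P} (h : Subgroup.zpowers v ⊔ commutator P = ⊤) :
    Subgroup.zpowers v = ⊤ := by
  by_contra hv
  obtain ⟨M, hM, hvM⟩ := (eq_top_or_exists_le_coatom (Subgroup.zpowers v)).resolve_left hv
  have hMn : M.Normal :=
    Subgroup.NormalizerCondition.normal_of_coatom _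
      Group.normalizerCondition_of_isNilpotent hM
  obtain ⟨x, hx⟩ : ∃ x, x ∉ M := by
    by_contra! hall
    exact hM.1 ((Subgroup.eq_top_iff' M).2 hall)
  have hsup : M ⊔ Subgroup.zpowers x = ⊤ :=
    hM.2 _ (left_lt_sup.2 fun hle => hx (hle (Subgroup.mem_zpowers x)))
  have hcyc : IsCyclic (P ⧸ M) := by
    refine ⟨(x : P ⧸ M), fun y => ?_⟩
    obtain ⟨g, rfl⟩ := QuotientGroup.mk_surjective y
    obtain ⟨m, hm, z, ⟨n, rfl⟩, rfl⟩ :=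
      Subgroup.mem_sup_of_normal_left.1 (hsup ▸ Subgroup.mem_top g)
    refine ⟨n, ?_⟩
    simp [(QuotientGroup.eq_one_iff m).2 hm]
  have hcomm : commutator P ≤ M :=
    (Subgroup.Normal.quotient_commutative_iff_commutator_le).1 hcyc.isMulCommutative
  exact hM.1 (top_le_iff.1 (h ▸ sup_le hvM hcomm))

/-- If a coprime-order automorphism of an abelian group of `p`-power exponent acts on a cyclic
equivariant quotient as multiplication by `t`, some eigenvector maps onto a generator. -/
theorem exists_eigenvector_of_coprime_pow_eq_one {V W : Type*} [AddCommGroup V] [AddCommGroup W]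
    [Nontrivial W] {p r M : ℕ} (hp : p.Prime) (hr : r.Coprime p) (σ : AddMonoid.End V)
    (hσ : σ ^ r = 1) (φ : V →+ W) (hφ : Function.Surjective φ) {t : ℤ}
    (ht : ∀ v, φ (σ v) = t • φ v) (hV : ∀ v : V, p ^ M • v = 0) {w : V}
    (hw : AddSubgroup.zmultiples (φ w) = ⊤) :
    ∃ (v : V) (T : ℤ), σ v = T • v ∧ AddSubgroup.zmultiples (φ v) = ⊤ := by
  have hr0 : r ≠ 0 := by
    rintro rfl
    exact hp.one_lt.ne' (by simpa using hr)
  have hW : ∀ x : W, ((p : ℤ) ^ M) • x = 0 := fun x => by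
    obtain ⟨v, rfl⟩ := hφ x
    rw [← map_zsmul]
    have := hV v
    rw [← natCast_zsmul] at this
    push_cast at this
    rw [this, map_zero]
  have hit : ∀ (n : ℕ) (v : V), φ ((σ ^ n) v) = t ^ n • φ v := fun n => by
    induction n with
    | zero => simp
    | succ n ih =>
      intro v
      rw [pow_succ, AddMonoid.End.coe_mul, Function.comp_apply, ih, ht, smul_smul, pow_succ]
  have htr : ∀ x : W, t ^ r • x = x := fun x => by
    obtain ⟨v, rfl⟩ := hφ x
    rw [← hit, hσ, AddMonoid.End.one_apply]
  have hpt : (p : ℤ) ∣ t ^ r - 1 := by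
    by_contra hnd
    have hco : IsCoprime ((p : ℤ) ^ M) (t ^ r - 1) :=
      ((Nat.prime_iff_prime_int.1 hp).coprime_iff_not_dvd.2 hnd).pow_left
    obtain ⟨a, b, hab⟩ := hco
    obtain ⟨x, hx⟩ := exists_ne (0 : W)
    apply hx
    calc x = (a * (p : ℤ) ^ M + b * (t ^ r - 1)) • x := by rw [hab, one_smul]
      _ = 0 := by rw [add_smul, mul_smul, mul_smul, hW, sub_smul, htr, one_smul]; simp
  have hptM : (p : ℤ) ^ M ∣ (t ^ r) ^ p ^ M - 1 := by
    have := dvd_sub_pow_of_dvd_sub hpt M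
    rw [one_pow] at this
    exact (pow_dvd_pow _ M.le_succ).trans this
  obtain ⟨s, hs0, hs1⟩ := Nat.chineseRemainder (Nat.Coprime.pow_left M hr.symm) 0 1
  obtain ⟨s', rfl⟩ := (Nat.modEq_zero_iff_dvd).1 hs0
  set T : ℤ := t ^ (p ^ M * s') with hT
  have hTr : (p : ℤ) ^ M ∣ T ^ r - 1 := by
    have h1 : T ^ r = ((t ^ r) ^ p ^ M) ^ s' := by rw [hT]; ring
    rw [h1]
    exact hptM.trans (by simpa using sub_dvd_pow_sub_pow ((t ^ r) ^ p ^ M) 1 s')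
  have hTW : ∀ x : W, T • x = t • x := fun x => by
    have key : ((t : AddMonoid.End W)) ^ r = 1 := by
      ext x
      rw [← Int.cast_pow, AddMonoid.End.intCast_apply, htr]; rfl
    have : ((t : AddMonoid.End W)) ^ (p ^ M * s') = (t : AddMonoid.End W) := by
      rw [pow_eq_pow_mod _ key, hs1, ← pow_eq_pow_mod _ key, pow_one]
    have := DFunLike.congr_fun this x
    rwa [← Int.cast_pow, AddMonoid.End.intCast_apply, AddMonoid.End.intCast_apply] at this
  have hTV : ((T : AddMonoid.End V)) ^ r = 1 := by
    ext x
    obtain ⟨c, hc⟩ := hTr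
    have hc' : T ^ r = c * (p : ℤ) ^ M + 1 := by linarith
    have := hV x
    rw [← natCast_zsmul] at this
    push_cast at this
    rw [← Int.cast_pow, AddMonoid.End.intCast_apply, hc', add_smul, mul_smul, this]
    simp
  set E : AddMonoid.End V :=
    ∑ i ∈ Finset.range r, σ ^ i * (T : AddMonoid.End V) ^ (r - 1 - i) with hE
  have hcomm : Commute σ (T : AddMonoid.End V) := (Int.cast_commute T σ).symm
  have hEeq : (σ - T) * E = 0 := by
    rw [hE, hcomm.mul_geom_sum₂, hσ, hTV, sub_self]
  refine ⟨E w, T, ?_, ?_⟩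
  · have := DFunLike.congr_fun hEeq w
    rw [sub_mul] at this
    have h2 : σ (E w) - (T : AddMonoid.End V) (E w) = 0 := this
    rw [AddMonoid.End.intCast_apply] at h2
    exact sub_eq_zero.1 h2
  · have hTn : ∀ (n : ℕ) (x : W), T ^ n • x = t ^ n • x := fun n x => by
      induction n with
      | zero => simp
      | succ n ih => rw [pow_succ', pow_succ', mul_smul, mul_smul, ih, hTW]
    have hφE : φ (E w) = ((r : ℤ) * t ^ (r - 1)) • φ w := by
      have h1 : E w = ∑ i ∈ Finset.range r, (σ ^ i) (T ^ (r - 1 - i) • w) := by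
        rw [hE]
        refine (AddMonoidHom.finsetSum_apply _ _ _).trans ?_
        refine Finset.sum_congr rfl fun i _ => ?_
        rw [← Int.cast_pow]
        rfl
      rw [h1, map_sum]
      have h2 : ∀ i ∈ Finset.range r,
          φ ((σ ^ i) (T ^ (r - 1 - i) • w)) = t ^ (r - 1) • φ w := fun i hi => by
        have hi' : i + (r - 1 - i) = r - 1 := by have := Finset.mem_range.1 hi; omega
        rw [hit, map_zsmul, hTn, smul_smul, ← pow_add, hi']
      rw [Finset.sum_congr rfl h2, Finset.sum_const, Finset.card_range, ← natCast_zsmul, smul_smul]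
    have htp : IsCoprime (t : ℤ) ((p : ℤ) ^ M) := by
      refine IsCoprime.pow_right ?_
      obtain ⟨c, hc⟩ := hpt
      refine ⟨t ^ (r - 1), -c, ?_⟩
      have : t ^ (r - 1) * t = t ^ r := by rw [← pow_succ]; congr 1; omega
      rw [this]; linarith
    have hco : IsCoprime ((r : ℤ) * t ^ (r - 1)) ((p : ℤ) ^ M) :=
      IsCoprime.mul_left (Nat.isCoprime_iff_coprime.2 hr).pow_right htp.pow_left
    obtain ⟨a, b, hab⟩ := hco
    rw [← top_le_iff, ← hw, AddSubgroup.zmultiples_le]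
    refine ⟨a, ?_⟩
    calc a • φ (E w) = (a * ((r : ℤ) * t ^ (r - 1)) + b * (p : ℤ) ^ M) • φ w := by
          rw [add_smul, mul_smul b, hW, smul_zero, add_zero, hφE, smul_smul]
      _ = φ w := by rw [hab, one_smul]

/-- A finite `p`-group with an operator `σ` of order prime to `p` and an equivariant surjection
onto a cyclic group contains a `σ`-invariant cyclic subgroup with the same image. -/
theorem exists_invariant_zpowers {p r : ℕ} (hp : p.Prime) (hr : r.Coprime p)
    {W : Type*} [CommGroup W] [Nontrivial W] [IsCyclic W] {t : ℤ}
    {P : Type*} [Group P] [Finite P] (hP : IsPGroup p P) (σ : P →* P)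
    (hσ : ∀ x, σ^[r] x = x) (f : P →* W) (hf : Function.Surjective f)
    (ht : ∀ x, f (σ x) = f x ^ t) :
    ∃ v : P, σ v ∈ Subgroup.zpowers v ∧ Subgroup.zpowers (f v) = ⊤ := by
  induction h : Nat.card P using Nat.strong_induction_on generalizing P with
  | _ n ih =>
  subst h
  have := Fact.mk hp
  obtain ⟨M, hM⟩ := hP.exists_card_eq
  obtain ⟨g, hg⟩ := IsCyclic.exists_generator (α := W)
  obtain ⟨w, rfl⟩ := hf g
  let σ' : AddMonoid.End (Additive (Abelianization P)) := (Abelianization.map σ).toAdditive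
  let φ : Additive (Abelianization P) →+ Additive W := (Abelianization.lift f).toAdditive
  have hind : ∀ x : Additive (Abelianization P),
      ∃ y : P, x = Additive.ofMul (Abelianization.of y) := fun x => by
    obtain ⟨y, hy⟩ := QuotientGroup.mk_surjective x.toMul
    exact ⟨y, congrArg Additive.ofMul hy.symm⟩
  have hσof : ∀ y : P, σ' (Additive.ofMul (Abelianization.of y)) =
      Additive.ofMul (Abelianization.of (σ y)) := fun y => rfl
  have hφof : ∀ y : P, φ (Additive.ofMul (Abelianization.of y)) =
      Additive.ofMul (f y) := fun y => rfl
  have hσit : ∀ (n : ℕ) (y : P), (σ' ^ n) (Additive.ofMul (Abelianization.of y)) =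
      Additive.ofMul (Abelianization.of (σ^[n] y)) := fun n => by
    induction n with
    | zero => intro y; rfl
    | succ n ih =>
      intro y
      rw [pow_succ, AddMonoid.End.coe_mul, Function.comp_apply, hσof, ih,
        Function.iterate_succ_apply]
  obtain ⟨x, T, hxT, hx⟩ := exists_eigenvector_of_coprime_pow_eq_one (M := M) hp hr σ'
    (by
      ext x
      obtain ⟨y, rfl⟩ := hind x
      rw [hσit, hσ]; rfl) φ
    (fun a => by
      obtain ⟨y, hy⟩ := hf a.toMul
      exact ⟨Additive.ofMul (Abelianization.of y), congrArg Additive.ofMul hy⟩)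
    (t := t)
    (fun x => by
      obtain ⟨y, rfl⟩ := hind x
      rw [hσof, hφof, hφof, ht]; rfl)
    (fun x => by
      obtain ⟨y, rfl⟩ := hind x
      rw [← hM, ← ofMul_pow, ← map_pow, pow_card_eq_one', map_one, ofMul_one])
    (w := Additive.ofMul (Abelianization.of w))
    (by
      rw [AddSubgroup.eq_top_iff']
      intro y
      obtain ⟨n, hn⟩ := hg y.toMul
      exact ⟨n, congrArg Additive.ofMul hn⟩)
  obtain ⟨v, rfl⟩ := hind x
  have hfv : Subgroup.zpowers (f v) = ⊤ := by
    rw [Subgroup.eq_top_iff']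
    intro y
    obtain ⟨n, hn⟩ := (AddSubgroup.eq_top_iff' _).1 hx (Additive.ofMul y)
    exact ⟨n, congrArg Additive.toMul hn⟩
  have hσv : (v ^ T)⁻¹ * σ v ∈ commutator P := by
    rw [← Abelianization.ker_of, MonoidHom.mem_ker, map_mul, map_inv, map_zpow]
    have : Abelianization.of (σ v) = Abelianization.of v ^ T := congrArg Additive.toMul hxT
    rw [this, inv_mul_cancel]
  set C : Subgroup P := Subgroup.zpowers v ⊔ commutator P with hC
  have hvC : v ∈ C := Subgroup.mem_sup_left (Subgroup.mem_zpowers v)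
  by_cases hCtop : C = ⊤
  · have := hP.isNilpotent
    exact ⟨v, zpowers_eq_top_of_sup_commutator_eq_top hCtop ▸ Subgroup.mem_top _, hfv⟩
  · have hσC : C ≤ C.comap σ := by
      rw [hC]
      refine sup_le ?_ ?_
      · rw [Subgroup.zpowers_le, Subgroup.mem_comap]
        have := Subgroup.mul_mem_sup (Subgroup.zpow_mem_zpowers v T) hσv
        rwa [mul_inv_cancel_left] at this
      · rw [← Subgroup.map_le_iff_le_comap, commutator_def, Subgroup.map_commutator]
        exact (Subgroup.commutator_mono le_top le_top).trans le_sup_right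
    let σC : C →* C := (σ.comp C.subtype).codRestrict C fun x => hσC x.2
    have hσCit : ∀ (n : ℕ) (x : C), ((σC^[n] x : C) : P) = σ^[n] x := fun n => by
      induction n with
      | zero => intro x; rfl
      | succ n ih => intro x; rw [Function.iterate_succ_apply, Function.iterate_succ_apply, ih]; rfl
    obtain ⟨u, ⟨k, hk⟩, hfu⟩ := ih (Nat.card C)
      (lt_of_le_of_ne (Subgroup.card_le_card_group C) fun h => hCtop (Subgroup.eq_top_of_card_eq C h))
      (hP.to_subgroup C) σC (fun x => Subtype.ext (by rw [hσCit, hσ]))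
      (f.comp C.subtype)
      (fun y => by
        obtain ⟨n, hn⟩ := (Subgroup.eq_top_iff' _).1 hfv y
        exact ⟨⟨v, hvC⟩ ^ n, by simpa using hn⟩)
      (fun x => ht x) rfl
    exact ⟨u, ⟨k, congrArg Subtype.val hk⟩, hfu⟩

/-- If `f` is surjective and a homomorphism `π` on a subgroup `K` with `f(K) = D` has kernel
contained in that of `f`, then `D` is a section of the target of `π`. -/
theorem isSection_of_ker_le {S D X : Type*} [Group S] [Group D] [Group X] (f : S →* D)
    (π : S →* X) (K : Subgroup S) (hK : K.map f = ⊤) (h : ∀ k ∈ K, π k = 1 → f k = 1) :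
    IsSection D X := by
  let g : K →* K.map π := π.subgroupMap K
  have hg : Function.Surjective g := π.subgroupMap_surjective K
  have hker : g.ker ≤ (f.comp K.subtype).ker := fun k hk =>
    h k k.2 (congrArg Subtype.val hk)
  refine ⟨K.map π, g.liftOfSurjective hg ⟨f.comp K.subtype, hker⟩, fun d => ?_⟩
  obtain ⟨k, hk, rfl⟩ : d ∈ K.map f := hK ▸ Subgroup.mem_top d
  exact ⟨g ⟨k, hk⟩, g.liftOfRightInverse_comp_apply _ _ ⟨f.comp K.subtype, hker⟩ ⟨k, hk⟩⟩

/-- If `D` is generated by the images of a cyclic subgroup `⟨v⟩` and an element `b` of order prime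
to `p` normalizing it, and `f v` generates a self-centralizing `p`-subgroup, then `D` is a section of
the target of every homomorphism that is injective on `⟨v⟩`. -/
theorem isSection_of_injOn_zpowers {p r : ℕ} {S D X : Type*} [Group S] [Finite S] [Group D]
    [Group X] (f : S →* D) (π : S →* X) {v b : S} (hr : r.Coprime p) (hbr : b ^ r = 1)
    (hbv : b * v * b⁻¹ ∈ Subgroup.zpowers v) (hA : IsPGroup p (Subgroup.zpowers (f v)))
    (hjoin : Subgroup.zpowers (f v) ⊔ Subgroup.zpowers (f b) = ⊤)
    (hcent : ∀ d : D, d * f v = f v * d → d ∈ Subgroup.zpowers (f v))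
    (hπ : ∀ x ∈ Subgroup.zpowers v, π x = 1 → x = 1) : IsSection D X := by
  have hbN : b ∈ Subgroup.normalizer (Subgroup.zpowers v : Set S) := by
    rw [Subgroup.mem_normalizer_iff_map_conj_eq]
    refine Subgroup.eq_of_le_of_card_ge ?_ ?_
    · rw [MonoidHom.map_zpowers, Subgroup.zpowers_le]
      exact hbv
    · rw [Subgroup.card_map_of_injective (MulAut.conj b).injective]
  have hbNle : Subgroup.zpowers b ≤ Subgroup.normalizer (Subgroup.zpowers v : Set S) := by
    rwa [Subgroup.zpowers_le]
  set K := Subgroup.zpowers v ⊔ Subgroup.zpowers b with hK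
  have hKN : K ≤ Subgroup.normalizer (Subgroup.zpowers v : Set S) :=
    sup_le Subgroup.le_normalizer hbNle
  have hpow : ∀ k ∈ K, k ^ r ∈ Subgroup.zpowers v := fun k hk => by
    have hk' : k ∈ (K : Set S) := hk
    rw [hK, Subgroup.coe_mul_of_right_le_normalizer_left _ _ hbNle] at hk'
    obtain ⟨x, hx, y, ⟨j, rfl⟩, rfl⟩ := hk'
    have key : ∀ n : ℕ, ∃ z ∈ Subgroup.zpowers v, (x * b ^ j) ^ n = z * (b ^ j) ^ n := fun n => by
      induction n with
      | zero => exact ⟨1, one_mem _, by simp⟩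
      | succ n ih =>
        obtain ⟨z, hz, hzn⟩ := ih
        refine ⟨x * (b ^ j * z * (b ^ j)⁻¹), mul_mem hx ?_, ?_⟩
        · exact (Subgroup.mem_normalizer_iff.1 (hbNle ⟨j, rfl⟩) z).1 hz
        · rw [pow_succ', hzn, pow_succ']; group
    obtain ⟨z, hz, hzr⟩ := key r
    have : (b ^ j) ^ r = 1 := by
      rw [← zpow_natCast, ← zpow_mul, mul_comm, zpow_mul, zpow_natCast, hbr, one_zpow]
    simp only
    rwa [hzr, this, mul_one]
  refine isSection_of_ker_le f π K ?_ fun k hk hπk => ?_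
  · rw [hK, Subgroup.map_sup, MonoidHom.map_zpowers, MonoidHom.map_zpowers, hjoin]
  · have hv : v ∈ Subgroup.zpowers v := Subgroup.mem_zpowers v
    have hcomm : k * v * k⁻¹ * v⁻¹ = 1 := hπ _
      (mul_mem ((Subgroup.mem_normalizer_iff.1 (hKN hk) v).1 hv) (inv_mem hv)) (by simp [hπk])
    have hkv : k * v = v * k := by
      rwa [mul_inv_eq_one, mul_inv_eq_iff_eq_mul] at hcomm
    have hfk : f k ∈ Subgroup.zpowers (f v) := hcent _ (by rw [← map_mul, hkv, map_mul])
    have hkr : k ^ r = 1 := hπ _ (hpow k hk) (by rw [map_pow, hπk, one_pow])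
    obtain ⟨m, hm⟩ := hA ⟨f k, hfk⟩
    have h1 : f k ^ p ^ m = 1 := congrArg Subtype.val hm
    have h2 : f k ^ r = 1 := by rw [← map_pow, hkr, map_one]
    have h3 := Nat.dvd_gcd (orderOf_dvd_of_pow_eq_one h2) (orderOf_dvd_of_pow_eq_one h1)
    rw [Nat.Coprime.pow_right m hr] at h3
    exact orderOf_eq_one_iff.1 (Nat.dvd_one.1 h3)

/-- A homomorphism that is not injective on a cyclic group of order `p ^ m` kills the power
`p ^ (m - 1)` of a generator. -/
theorem injOn_zpowers_or_map_pow_eq_one {p m : ℕ} (hp : p.Prime) {S X : Type*} [Group S] [Group X]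
    (π : S →* X) {v : S} (hv : orderOf v = p ^ m) :
    (∀ x ∈ Subgroup.zpowers v, π x = 1 → x = 1) ∨ π (v ^ p ^ (m - 1)) = 1 := by
  obtain ⟨i, hi, hπ⟩ := (Nat.dvd_prime_pow hp).1 (hv ▸ orderOf_map_dvd π v)
  rcases hi.eq_or_lt with rfl | hlt
  · left
    rintro _ ⟨n, rfl⟩ hx
    simp only [map_zpow] at hx ⊢
    rwa [← orderOf_dvd_iff_zpow_eq_one, hv, ← hπ, orderOf_dvd_iff_zpow_eq_one]
  · right
    rw [map_pow, ← orderOf_dvd_iff_pow_eq_one, hπ]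
    exact pow_dvd_pow p (Nat.le_sub_one_of_lt hlt)

/-- Two homomorphisms whose kernels meet trivially cannot both fail to be injective on a cyclic
`p`-group. -/
theorem injOn_zpowers_or_of_ker_inf_ker {p m : ℕ} (hp : p.Prime) {S X Y : Type*} [Group S]
    [Group X] [Group Y] (π₁ : S →* X) (π₂ : S →* Y) (h : ∀ s, π₁ s = 1 → π₂ s = 1 → s = 1)
    {v : S} (hv : orderOf v = p ^ m) :
    (∀ x ∈ Subgroup.zpowers v, π₁ x = 1 → x = 1) ∨
      ∀ x ∈ Subgroup.zpowers v, π₂ x = 1 → x = 1 := by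
  rcases injOn_zpowers_or_map_pow_eq_one hp π₁ hv with h₁ | h₁
  · exact Or.inl h₁
  rcases injOn_zpowers_or_map_pow_eq_one hp π₂ hv with h₂ | h₂
  · exact Or.inr h₂
  have hdvd := orderOf_dvd_of_pow_eq_one (h _ h₁ h₂)
  rw [hv, Nat.pow_dvd_pow_iff_le_right hp.one_lt] at hdvd
  obtain rfl : m = 0 := by omega
  rw [pow_zero, orderOf_eq_one_iff] at hv
  subst hv
  exact Or.inl fun x hx _ => by simpa using hx

theorem zpowers_eq_of_card_prime {q : ℕ} (hq : q.Prime) {D : Type*} [Group D] {B : Subgroup D}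
    (hB : Nat.card B = q) {x : D} (hx : x ∈ B) (hx1 : x ≠ 1) : Subgroup.zpowers x = B := by
  have := Fact.mk hq
  have h := congrArg (Subgroup.map B.subtype)
    (zpowers_eq_top_of_prime_card hB (g := ⟨x, hx⟩) fun h => hx1 (congrArg Subtype.val h))
  rwa [MonoidHom.map_zpowers, ← MonoidHom.range_eq_map, Subgroup.range_subtype] at h

/-- Given a finite group mapping onto `D`, a cyclic normal `p`-subgroup `A` of `D` and a subgroup
`B` of prime order `q ≠ p` lift to a cyclic `p`-group normalized by a cyclic `p'`-group. -/
theorem exists_lift_generators {p q : ℕ} (hp : p.Prime) (hq : q.Prime) (hpq : p ≠ q)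
    {D : Type*} [Group D] {A B : Subgroup D} (hAnorm : A.Normal) [IsCyclic A] [Nontrivial A]
    (hAp : IsPGroup p A) (hBq : Nat.card B = q) {S : Type*} [Group S] [Finite S] (f : S →* D)
    (hf : Function.Surjective f) :
    ∃ (v b : S) (m r : ℕ), orderOf v = p ^ m ∧ r.Coprime p ∧ b ^ r = 1 ∧
      b * v * b⁻¹ ∈ Subgroup.zpowers v ∧ Subgroup.zpowers (f v) = A ∧
      Subgroup.zpowers (f b) = B := by
  have := Fact.mk hp
  let L : Subgroup S := A.comap f
  let g : L →* A := f.subgroupComap A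
  have hg : Function.Surjective g := fun a => by
    obtain ⟨s, hs⟩ := hf a
    exact ⟨⟨s, by simp [L, hs]⟩, Subtype.ext hs⟩
  obtain ⟨P₀⟩ : Nonempty (Sylow p L) := inferInstance
  have hPA : (P₀ : Subgroup L).map g = ⊤ := by
    have h1 : IsPGroup p (⊤ : Subgroup A) := hAp.to_subgroup ⊤
    exact ((P₀.mapSurjective hg).is_maximal' h1 le_top).symm
  set P : Subgroup S := (P₀ : Subgroup L).map L.subtype with hP
  have hPp : IsPGroup p P := P₀.isPGroup'.map _
  have hPL : P ≤ L := Subgroup.map_subtype_le _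
  have hPsurj : ∀ a ∈ A, ∃ x ∈ P, f x = a := fun a ha => by
    obtain ⟨x, hx, hxa⟩ : (⟨a, ha⟩ : A) ∈ (P₀ : Subgroup L).map g := hPA ▸ Subgroup.mem_top _
    exact ⟨x, ⟨x, hx, rfl⟩, congrArg Subtype.val hxa⟩
  have hfrat : Subgroup.normalizer (P : Set S) ⊔ L = ⊤ := Sylow.normalizer_sup_eq_top P₀
  obtain ⟨b₀, hb₀⟩ : ∃ b : B, b ≠ 1 := by
    have : Finite B := Nat.finite_of_card_ne_zero (hBq ▸ hq.ne_zero)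
    have : Nontrivial B := Finite.one_lt_card_iff_nontrivial.1 (hBq ▸ hq.one_lt)
    exact exists_ne 1
  obtain ⟨c, hcN, hcb⟩ : ∃ c ∈ Subgroup.normalizer (P : Set S), f c = b₀ := by
    obtain ⟨s, hs⟩ := hf b₀
    obtain ⟨n, hn, l, hl, rfl⟩ := Subgroup.mem_sup_of_normal_right.1 (hfrat ▸ Subgroup.mem_top s)
    obtain ⟨x, hx, hxl⟩ := hPsurj (f l) hl
    exact ⟨n * x, mul_mem hn (Subgroup.le_normalizer hx), by rw [map_mul, hxl, ← map_mul, hs]⟩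
  obtain ⟨k, r, hr, hkr⟩ :=
    Nat.exists_eq_pow_mul_and_not_dvd (orderOf_pos c).ne' p hp.ne_one
  set b := c ^ p ^ k with hb
  have hbr : b ^ r = 1 := by rw [hb, ← pow_mul, ← hkr, pow_orderOf_eq_one]
  have hrp : r.Coprime p := ((hp.coprime_iff_not_dvd).2 hr).symm
  have hbN : b ∈ Subgroup.normalizer (P : Set S) := pow_mem hcN _
  have hfb : Subgroup.zpowers (f b) = B := by
    have hfb' : f b = (b₀ : D) ^ p ^ k := by rw [hb, map_pow, hcb]
    refine zpowers_eq_of_card_prime hq hBq (hfb' ▸ pow_mem b₀.2 _) fun h1 => hb₀ ?_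
    have h2 : b₀ ^ p ^ k = 1 := Subtype.ext (by simpa using hfb'.symm.trans h1)
    have h3 : b₀ ^ q = 1 := hBq ▸ pow_card_eq_one'
    have h4 := Nat.dvd_gcd (orderOf_dvd_of_pow_eq_one h2) (orderOf_dvd_of_pow_eq_one h3)
    rw [((Nat.coprime_primes hp hq).2 hpq).pow_left k] at h4
    exact orderOf_eq_one_iff.1 (Nat.dvd_one.1 h4)
  let σ : P →* P := (((MulAut.conj b).toMonoidHom).comp P.subtype).codRestrict P
    fun x => (Subgroup.mem_normalizer_iff.1 hbN x).1 x.2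
  have hσ : ∀ x : P, ((σ x : P) : S) = b * x * b⁻¹ := fun x => rfl
  have hσit : ∀ (n : ℕ) (x : P), ((σ^[n] x : P) : S) = b ^ n * x * (b ^ n)⁻¹ := fun n => by
    induction n with
    | zero => simp
    | succ n ih => intro x; rw [Function.iterate_succ_apply, ih, hσ, pow_succ]; group
  let fP : P →* A := (f.comp P.subtype).codRestrict A fun x => hPL x.2
  obtain ⟨t, ht⟩ := MonoidHom.map_cyclic (MulAut.conjNormal (H := A) (f b)).toMonoidHom
  let _ : CommGroup A := IsCyclic.commGroup
  obtain ⟨v, ⟨j, hj⟩, hfv⟩ := exists_invariant_zpowers hp hrp hPp σ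
    (fun x => Subtype.ext (by rw [hσit, hbr]; simp)) fP
    (fun a => by
      obtain ⟨x, hx, hxa⟩ := hPsurj a a.2
      exact ⟨⟨x, hx⟩, Subtype.ext hxa⟩)
    (t := t)
    (fun x => by
      rw [← ht]
      refine Subtype.ext ?_
      change f (σ x) = f b * f x * (f b)⁻¹
      rw [hσ, map_mul, map_mul, map_inv])
  obtain ⟨m, hm⟩ := (IsPGroup.iff_orderOf.1 hPp) v
  refine ⟨v, b, m, r, by rw [Subgroup.orderOf_coe, hm], hrp, hbr, ⟨j, ?_⟩, ?_, hfb⟩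
  · rw [← hσ, ← hj]; rfl
  · have := congrArg (Subgroup.map A.subtype) hfv
    rwa [MonoidHom.map_zpowers, ← MonoidHom.range_eq_map, Subgroup.range_subtype] at this

theorem Subgroup.FG.map_hom {G H : Type*} [Group G] [Group H] {S : Subgroup G} (hS : S.FG)
    (f : G →* H) : (S.map f).FG := by
  obtain ⟨F, rfl, hF⟩ := (Subgroup.fg_iff S).1 hS
  exact (Subgroup.fg_iff _).2 ⟨f '' F, (MonoidHom.map_closure f F).symm, hF.image f⟩

theorem IsLocallyFinite.prod {X Y : Type*} [Group X] [Group Y] (hX : IsLocallyFinite X)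
    (hY : IsLocallyFinite Y) : IsLocallyFinite (X × Y) := by
  intro S hS
  have h₁ := hX _ (hS.map_hom (MonoidHom.fst X Y))
  have h₂ := hY _ (hS.map_hom (MonoidHom.snd X Y))
  refine Finite.of_injective
    (fun s : S => ((⟨s.1.1, s.1, s.2, rfl⟩ : S.map (MonoidHom.fst X Y)),
      (⟨s.1.2, s.1, s.2, rfl⟩ : S.map (MonoidHom.snd X Y)))) fun s t h => ?_
  obtain ⟨h1, h2⟩ := Prod.mk.inj h
  exact Subtype.ext (Prod.ext (congrArg Subtype.val h1) (congrArg Subtype.val h2))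

/-- A finite section of a locally finite group is an image of a finite subgroup. -/
theorem IsSection.exists_finite {D X : Type*} [Group D] [Finite D] [Group X]
    (h : IsSection D X) (hX : IsLocallyFinite X) :
    ∃ (S : Subgroup X) (f : S →* D), Finite S ∧ Function.Surjective f := by
  obtain ⟨K, f, hf⟩ := h
  let T : Subgroup K := Subgroup.closure (Set.range (Function.surjInv hf))
  have hT : (T.map K.subtype).FG :=
    ((Subgroup.fg_iff T).2 ⟨_, rfl, Set.finite_range _⟩).map_hom _
  have hfin := hX _ hT
  have hle : T.map K.subtype ≤ K := Subgroup.map_subtype_le _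
  refine ⟨T.map K.subtype, f.comp (Subgroup.inclusion hle), hfin, fun d => ?_⟩
  exact ⟨⟨_, ⟨Function.surjInv hf d, Subgroup.subset_closure ⟨d, rfl⟩, rfl⟩⟩,
    Function.surjInv_eq hf d⟩

theorem kovacs_dihedral {p q : ℕ} (hp : p.Prime) (hq : q.Prime) (hpq : p ≠ q)
    {D : Type*} [Group D] (A B : Subgroup D) (hAnorm : A.Normal)
    (hAcyc : IsCyclic A) (hAp : IsPGroup p A) (hBq : Nat.card B = q)
    (hint : A ⊓ B = ⊥) (hjoin : A ⊔ B = ⊤) (hcomm : ⁅A, B⁆ ≠ ⊥)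
    {X Y : Type*} [Group X] [Group Y]
    (hX : IsLocallyFinite X) (hY : IsLocallyFinite Y)
    (hsec : IsSection D (X × Y)) :
    IsSection D X ∨ IsSection D Y := by
  have hAnt : Nontrivial A := by
    rw [Subgroup.nontrivial_iff_ne_bot]
    rintro rfl
    exact hcomm (Subgroup.commutator_bot_left B)
  have hBfin : Finite B := Nat.finite_of_card_ne_zero (hBq ▸ hq.ne_zero)
  have hAfin : Finite A := by
    obtain ⟨g, hg⟩ := hAcyc.exists_generator
    obtain ⟨k, hk⟩ := hAp g
    have : Finite (Subgroup.zpowers g) :=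
      finite_zpowers.2 (isOfFinOrder_iff_pow_eq_one.2 ⟨_, pow_pos hp.pos k, hk⟩)
    exact Finite.of_surjective (fun x : Subgroup.zpowers g => (x : A)) fun a => ⟨⟨a, hg a⟩, rfl⟩
  have hdecomp : ∀ d : D, ∃ a ∈ A, ∃ b ∈ B, a * b = d := fun d =>
    Subgroup.mem_sup_of_normal_left.1 (hjoin ▸ Subgroup.mem_top d)
  have hDfin : Finite D :=
    Finite.of_surjective (fun x : A × B => (x.1 : D) * x.2) fun d => by
      obtain ⟨a, ha, b, hb, rfl⟩ := hdecomp d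
      exact ⟨(⟨a, ha⟩, ⟨b, hb⟩), rfl⟩
  obtain ⟨S, f, hSfin, hf⟩ := hsec.exists_finite (hX.prod hY)
  obtain ⟨v, b, m, r, hv, hr, hbr, hbv, hfv, hfb⟩ :=
    exists_lift_generators hp hq hpq hAnorm hAp hBq f hf
  have hcent : ∀ d : D, d * f v = f v * d → d ∈ Subgroup.zpowers (f v) := fun d hd => by
    rw [hfv]
    obtain ⟨a, ha, y, hy, rfl⟩ := hdecomp d
    have hav : Commute a (f v) := by
      obtain ⟨n, rfl⟩ := hfv.symm ▸ ha
      exact (Commute.refl (f v)).zpow_left n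
    have hyv : Commute (f v) y :=
      (mul_left_cancel (a := a) (by rw [← mul_assoc, ← mul_assoc, hd, hav.eq, mul_assoc])).symm
    obtain rfl : y = 1 := by
      by_contra hy1
      refine hcomm (Subgroup.commutator_eq_bot_iff_le_centralizer.2 ?_)
      rw [← hfv, ← zpowers_eq_of_card_prime hq hBq hy hy1]
      rintro _ ⟨i, rfl⟩ _ ⟨j, rfl⟩
      exact (hyv.zpow_zpow i j).symm
    rwa [mul_one]
  have hjoin' : Subgroup.zpowers (f v) ⊔ Subgroup.zpowers (f b) = ⊤ := by rw [hfv, hfb, hjoin]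
  have hA' : IsPGroup p (Subgroup.zpowers (f v)) := hfv ▸ hAp
  refine (injOn_zpowers_or_of_ker_inf_ker hp ((MonoidHom.fst X Y).comp S.subtype)
    ((MonoidHom.snd X Y).comp S.subtype) (fun s h₁ h₂ => Subtype.ext (Prod.ext h₁ h₂)) hv).imp
    ?_ ?_
  · exact isSection_of_injOn_zpowers f _ hr hbr hbv hA' hjoin' hcent
  · exact isSection_of_injOn_zpowers f _ hr hbr hbv hA' hjoin' hcent
end

section
/- Let p and q be distinct primes and let D be a group that is an internal semidirect product D = A ⋊ B of a cyclic p-group A (normal in D) and a subgroup B of order q, with [A, B] ≠ 1. Then every proper normal subgroup of D is a p-group. -/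
theorem conj_pow_eq_zpow_pow {G : Type*} [Group G] {c g : G} {k : ℤ}
    (h : c * g * c⁻¹ = g ^ k) (n : ℕ) : c ^ n * g * (c ^ n)⁻¹ = g ^ (k ^ n) := by
  induction n with
  | zero => simp
  | succ n ih =>
    calc c ^ (n + 1) * g * (c ^ (n + 1))⁻¹ = c * (c ^ n * g * (c ^ n)⁻¹) * c⁻¹ := by
          rw [pow_succ']; group
      _ = g ^ (k ^ (n + 1)) := by
          rw [ih, ← conj_zpow, h, ← zpow_mul, pow_succ']

/-- If `p ∣ k - 1` and `q` is a prime other than `p`, then `1 + k + ⋯ + k ^ (q - 1)`, being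
congruent to `q` modulo `p`, is coprime to `p`. -/
theorem isCoprime_geom_sum_of_dvd_sub_one {p q : ℕ} (hp : p.Prime) (hq : q.Prime)
    (hpq : p ≠ q) {k : ℤ} (hk : (p : ℤ) ∣ k - 1) :
    IsCoprime (p : ℤ) (∑ i ∈ Finset.range q, k ^ i) := by
  rw [(Nat.prime_iff_prime_int.mp hp).coprime_iff_not_dvd]
  intro hdvd
  have hsum : (p : ℤ) ∣ (∑ i ∈ Finset.range q, k ^ i) - q := by
    have : (∑ i ∈ Finset.range q, k ^ i) - (q : ℤ) = ∑ i ∈ Finset.range q, (k ^ i - 1) := by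
      simp
    rw [this]
    exact Finset.dvd_sum fun i _ => hk.trans (sub_one_dvd_pow_sub_one k i)
  have hpq' : p ∣ q := by
    have := dvd_sub hdvd hsum
    rw [sub_sub_cancel] at this
    exact_mod_cast this
  exact hpq ((Nat.prime_dvd_prime_iff_eq hp hq).mp hpq')

/-- Conjugation by an element of order dividing `q` that raises a `p`-element `g` to the power `k`
either fixes `g`, or `k - 1` is coprime to the order of `g`. -/
theorem zpow_eq_self_or_isCoprime_orderOf {G : Type*} [Group G] {p q : ℕ} (hp : p.Prime)
    (hq : q.Prime) (hpq : p ≠ q) {c g : G} {k : ℤ} {m : ℕ} (hg : orderOf g = p ^ m)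
    (hc : c ^ q = 1) (h : c * g * c⁻¹ = g ^ k) :
    g ^ k = g ∨ IsCoprime (orderOf g : ℤ) (k - 1) := by
  rw [hg, Nat.cast_pow]
  by_cases hk : (p : ℤ) ∣ k - 1
  · left
    have hkq : (orderOf g : ℤ) ∣ (∑ i ∈ Finset.range q, k ^ i) * (k - 1) := by
      rw [geom_sum_mul, orderOf_dvd_iff_zpow_eq_one, zpow_sub_one, ← conj_pow_eq_zpow_pow h, hc]
      simp
    have hcop : IsCoprime (orderOf g : ℤ) (∑ i ∈ Finset.range q, k ^ i) := by
      rw [hg, Nat.cast_pow]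
      exact (isCoprime_geom_sum_of_dvd_sub_one hp hq hpq hk).pow_left
    have := orderOf_dvd_iff_zpow_eq_one.mp (hcop.dvd_of_dvd_mul_left hkq)
    rwa [zpow_sub_one, mul_inv_eq_one] at this
  · exact Or.inr (((Nat.prime_iff_prime_int.mp hp).coprime_iff_not_dvd.mpr hk).pow_left)

theorem Subgroup.mem_of_zpow_mem_of_isCoprime_orderOf {G : Type*} [Group G] {H : Subgroup G}
    {g : G} {j : ℤ} (hj : IsCoprime (orderOf g : ℤ) j) (h : g ^ j ∈ H) : g ∈ H := by
  obtain ⟨u, v, huv⟩ := hj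
  have : g = (g ^ j) ^ v := by
    conv_lhs => rw [← zpow_one g, ← huv, zpow_add, mul_comm u, zpow_mul, zpow_natCast,
      pow_orderOf_eq_one, one_zpow, one_mul, mul_comm v, zpow_mul]
  rw [this]
  exact H.zpow_mem h v

theorem proper_normal_subgroups_are_p_groups {p q : ℕ} (hp : p.Prime) (hq : q.Prime)
    (hpq : p ≠ q)
    {D : Type*} [Group D] (A B : Subgroup D) (hAnorm : A.Normal)
    (hAcyc : IsCyclic A) (hAp : IsPGroup p A) (hBq : Nat.card B = q)
    (hint : A ⊓ B = ⊥) (hjoin : A ⊔ B = ⊤) (hcomm : ⁅A, B⁆ ≠ ⊥)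
    (N : Subgroup D) (hN : N.Normal) (hNproper : N ≠ ⊤) :
    IsPGroup p N := by
  by_cases hNA : N ≤ A
  · exact hAp.to_le hNA
  exfalso
  obtain ⟨x, hxN, hxA⟩ := SetLike.not_le_iff_exists.mp hNA
  obtain ⟨a, ha, c, hc, rfl⟩ := Subgroup.mem_sup_of_normal_left.mp (hjoin ▸ Subgroup.mem_top x)
  have hc1 : c ≠ 1 := by
    rintro rfl
    exact hxA (by simpa using ha)
  obtain ⟨g, rfl⟩ := (Subgroup.isCyclic_iff_exists_zpowers_eq_top A).mp hAcyc
  have hcq : c ^ q = 1 := by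
    rw [← hBq]
    exact congrArg Subtype.val (pow_card_eq_one' (x := (⟨c, hc⟩ : B)))
  have hBc : B = Subgroup.zpowers c := by
    have : Fact q.Prime := ⟨hq⟩
    refine le_antisymm (fun b hb => ?_) (Subgroup.zpowers_le.mpr hc)
    have hmem := mem_zpowers_of_prime_card hBq (g := (⟨c, hc⟩ : B)) (g' := ⟨b, hb⟩)
      (fun h => hc1 (congrArg Subtype.val h))
    obtain ⟨n, hn⟩ := hmem
    exact ⟨n, congrArg Subtype.val hn⟩
  have hg := Subgroup.mem_zpowers g
  obtain ⟨k, hk⟩ := Subgroup.mem_zpowers_iff.mp (hAnorm.conj_mem g hg c)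
  obtain ⟨m, hm⟩ : ∃ m, orderOf g = p ^ m := by
    have : Fact p.Prime := ⟨hp⟩
    obtain ⟨m, hm⟩ := IsPGroup.iff_orderOf.mp hAp ⟨g, hg⟩
    exact ⟨m, by rw [← hm, Subgroup.orderOf_mk]⟩
  rcases zpow_eq_self_or_isCoprime_orderOf hp hq hpq hm hcq hk.symm with hfix | hcop
  · apply hcomm
    rw [hBc, Subgroup.commutator_eq_bot_iff_le_centralizer, Subgroup.zpowers_le,
      Subgroup.mem_centralizer_iff]
    have hcg : Commute c g := by
      rw [hfix] at hk
      exact (mul_inv_eq_iff_eq_mul.mp hk.symm)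
    rintro _ ⟨n, rfl⟩
    exact (hcg.zpow_left n).eq
  · obtain ⟨i, rfl⟩ := ha
    have hgN : g ∈ N := by
      refine Subgroup.mem_of_zpow_mem_of_isCoprime_orderOf hcop ?_
      have hcomm_mem : (g ^ i * c) * (g * (g ^ i * c)⁻¹ * g⁻¹) ∈ N :=
        N.mul_mem hxN (hN.conj_mem _ (N.inv_mem hxN) g)
      have hcalc : (g ^ i * c) * (g * (g ^ i * c)⁻¹ * g⁻¹) = g ^ (k - 1) := by
        calc _ = g ^ i * (c * g * c⁻¹) * (g ^ i)⁻¹ * g⁻¹ := by group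
          _ = g ^ (k - 1) := by rw [← hk]; group
      exact hcalc ▸ hcomm_mem
    have hcN : c ∈ N := (N.mul_mem_cancel_left (N.zpow_mem hgN i)).mp hxN
    apply hNproper
    rw [← top_le_iff, ← hjoin, hBc]
    exact sup_le (Subgroup.zpowers_le.mpr hgN) (Subgroup.zpowers_le.mpr hcN)
end

section
/- Let p and q be distinct primes and let D be a group that is an internal semidirect product D = A ⋊ B of a cyclic p-group A (normal in D) and a subgroup B of order q, with [A, B] ≠ 1. Then the normal subgroups of D form a chain: for any two normal subgroups N₁, N₂ of D one has N₁ ≤ N₂ or N₂ ≤ N₁. -/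
open scoped commutatorElement

/-- If `a` has `p`-power order, then of two powers of `a` one is a power of the other. -/
theorem mem_zpowers_or_mem_zpowers_of_pow_prime_pow_eq_one {G : Type*} [Group G] {p n : ℕ}
    (hp : p.Prime) {a x y : G} (ha : a ^ p ^ n = 1) (hx : x ∈ Subgroup.zpowers a)
    (hy : y ∈ Subgroup.zpowers a) :
    x ∈ Subgroup.zpowers y ∨ y ∈ Subgroup.zpowers x := by
  have key : ∀ i j : ℤ, (i.gcd (p ^ n : ℕ) : ℤ) ∣ j → a ^ j ∈ Subgroup.zpowers (a ^ i) := by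
    rintro i j ⟨c, hc⟩
    refine ⟨i.gcdA (p ^ n : ℕ) * c, ?_⟩
    have h : j = i * (i.gcdA (p ^ n : ℕ) * c) + (p ^ n : ℕ) * (i.gcdB (p ^ n : ℕ) * c) := by
      rw [Int.gcd_eq_gcd_ab] at hc
      rw [hc]
      ring
    change (a ^ i) ^ (i.gcdA (p ^ n : ℕ) * c) = a ^ j
    rw [h, zpow_add, zpow_mul a (p ^ n : ℕ), zpow_natCast a (p ^ n), ha, one_zpow, mul_one,
      zpow_mul a i]
  obtain ⟨i, rfl⟩ := hx
  obtain ⟨j, rfl⟩ := hy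
  have hdvd : ∀ i : ℤ, i.gcd (p ^ n : ℕ) ∣ p ^ n := fun i => by
    exact_mod_cast Int.gcd_dvd_right i (p ^ n : ℕ)
  obtain ⟨s, -, hs⟩ := (Nat.dvd_prime_pow hp).1 (hdvd i)
  obtain ⟨t, -, ht⟩ := (Nat.dvd_prime_pow hp).1 (hdvd j)
  rcases le_total s t with h | h
  · refine Or.inr (key i j (dvd_trans ?_ (Int.gcd_dvd_left j (p ^ n : ℕ))))
    rw [hs, ht]
    exact_mod_cast pow_dvd_pow p h
  · refine Or.inl (key j i (dvd_trans ?_ (Int.gcd_dvd_left i (p ^ n : ℕ))))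
    rw [hs, ht]
    exact_mod_cast pow_dvd_pow p h

/-- An integer that is `1` modulo `p` and whose `q`-th power is `1` modulo `p ^ n`, where `q` is
prime to `p`, is `1` modulo `p ^ n`. -/
theorem Int.prime_pow_dvd_sub_one_of_dvd_pow_sub_one {p q n : ℕ} (hp : p.Prime)
    (hpq : p.Coprime q) {k : ℤ} (hk : (p : ℤ) ∣ k - 1) (hkq : (p ^ n : ℤ) ∣ k ^ q - 1) :
    (p ^ n : ℤ) ∣ k - 1 := by
  have hgeom : ((p : ℤ)) ∣ (∑ i ∈ Finset.range q, k ^ i) - q := by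
    have h : (∑ i ∈ Finset.range q, k ^ i) - q = ∑ i ∈ Finset.range q, (k ^ i - 1) := by
      simp
    rw [h]
    exact Finset.dvd_sum fun i _ => hk.trans (sub_one_dvd_pow_sub_one k i)
  have hndvd : ¬ (p : ℤ) ∣ ∑ i ∈ Finset.range q, k ^ i := fun h => by
    have hq : (p : ℤ) ∣ q := (dvd_sub_right h).1 hgeom
    exact hp.one_lt.ne' (hpq.eq_one_of_dvd (Int.natCast_dvd_natCast.1 hq))
  have hcop : IsCoprime (p ^ n : ℤ) (∑ i ∈ Finset.range q, k ^ i) :=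
    ((Nat.prime_iff_prime_int.1 hp).coprime_iff_not_dvd.2 hndvd).pow_left
  rw [← geom_sum_mul] at hkq
  exact hcop.dvd_of_dvd_mul_left hkq

/-- An element of order prime to `p` that normalizes but does not centralize a cyclic `p`-group
has a commutator with the generator that generates the whole group. -/
theorem mem_zpowers_commutator_of_conj_mem_zpowers {G : Type*} [Group G] {p q n : ℕ}
    (hp : p.Prime) (hpq : p.Coprime q) {a b : G} (ha : a ^ p ^ n = 1) (hb : b ^ q = 1)
    (hab : b * a * b⁻¹ ∈ Subgroup.zpowers a) (hne : ¬ Commute b a) :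
    a ∈ Subgroup.zpowers ⁅b, a⁆ := by
  obtain ⟨k, hk⟩ := hab
  replace hk : b * a * b⁻¹ = a ^ k := hk.symm
  have hiter : ∀ i : ℕ, b ^ i * a * (b ^ i)⁻¹ = a ^ k ^ i := by
    intro i
    induction i with
    | zero => simp
    | succ i ih =>
      calc b ^ (i + 1) * a * (b ^ (i + 1))⁻¹ = b * (b ^ i * a * (b ^ i)⁻¹) * b⁻¹ := by
            rw [pow_succ']; group
        _ = a ^ k ^ (i + 1) := by rw [ih, ← conj_zpow, hk, ← zpow_mul, pow_succ']
  have hc : ⁅b, a⁆ = a ^ (k - 1) := by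
    rw [commutatorElement_def, hk, zpow_sub_one]
  have hkq : a ^ (k ^ q - 1) = 1 := by
    rw [zpow_sub_one, ← hiter q, hb]
    simp
  obtain ⟨m, -, hm⟩ := (Nat.dvd_prime_pow hp).1 (orderOf_dvd_of_pow_eq_one ha)
  have hdvd : (p ^ m : ℤ) ∣ k ^ q - 1 := by
    have := orderOf_dvd_iff_zpow_eq_one.2 hkq
    rw [hm] at this
    exact_mod_cast this
  have hndvd : ¬ (p : ℤ) ∣ k - 1 := fun h => by
    have h1 : a ^ (k - 1) = 1 := by
      rw [← orderOf_dvd_iff_zpow_eq_one, hm]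
      exact_mod_cast Int.prime_pow_dvd_sub_one_of_dvd_pow_sub_one hp hpq h hdvd
    exact hne (commutatorElement_eq_one_iff_commute.1 (hc.trans h1))
  obtain ⟨u, v, huv⟩ :=
    ((Nat.prime_iff_prime_int.1 hp).coprime_iff_not_dvd.2 hndvd).pow_left (m := n)
  refine ⟨v, ?_⟩
  change ⁅b, a⁆ ^ v = a
  have h : (k - 1) * v = 1 + (p ^ n : ℕ) * -u := by
    push_cast
    linear_combination huv
  rw [hc, ← zpow_mul, h, zpow_add, zpow_mul, zpow_natCast, ha, one_zpow, mul_one, zpow_one]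

theorem normal_subgroups_form_chain {p q : ℕ} (hp : p.Prime) (hq : q.Prime)
    (hpq : p ≠ q)
    {D : Type*} [Group D] (A B : Subgroup D) (hAnorm : A.Normal)
    (hAcyc : IsCyclic A) (hAp : IsPGroup p A) (hBq : Nat.card B = q)
    (hint : A ⊓ B = ⊥) (hjoin : A ⊔ B = ⊤) (hcomm : ⁅A, B⁆ ≠ ⊥)
    (N₁ N₂ : Subgroup D) (hN₁ : N₁.Normal) (hN₂ : N₂.Normal) :
    N₁ ≤ N₂ ∨ N₂ ≤ N₁ := by
  obtain ⟨a, rfl⟩ := (Subgroup.isCyclic_iff_exists_zpowers_eq_top A).1 hAcyc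
  obtain ⟨n, hn⟩ := hAp ⟨a, Subgroup.mem_zpowers a⟩
  have ha : a ^ p ^ n = 1 := by simpa using congrArg Subtype.val hn
  have htop : ∀ N : Subgroup D, N.Normal → ¬ N ≤ Subgroup.zpowers a → N = ⊤ := by
    intro N hN hNA
    obtain ⟨x, hxN, hxA⟩ := SetLike.not_le_iff_exists.1 hNA
    obtain ⟨c, hc, b, hb, rfl⟩ := Subgroup.mem_sup_of_normal_left.1
      (hjoin ▸ Subgroup.mem_top x : x ∈ Subgroup.zpowers a ⊔ B)
    have hb1 : b ≠ 1 := by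
      rintro rfl
      exact hxA (by simpa using hc)
    have hBb : B ≤ Subgroup.zpowers b := by
      have := Fact.mk hq
      intro y hy
      obtain ⟨i, hi⟩ := mem_zpowers_of_prime_card hBq (g := ⟨b, hb⟩) (g' := ⟨y, hy⟩)
        (by simpa using hb1)
      exact ⟨i, by simpa using congrArg Subtype.val hi⟩
    have hbq : b ^ q = 1 := by
      have : (⟨b, hb⟩ : B) ^ q = 1 := hBq ▸ pow_card_eq_one'
      simpa using congrArg Subtype.val this
    have hne : ¬ Commute b a := by
      intro h
      refine hcomm (Subgroup.commutator_eq_bot_iff_le_centralizer.2 ?_)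
      rintro _ ⟨i, rfl⟩
      rw [Subgroup.mem_centralizer_iff]
      intro y hy
      obtain ⟨j, rfl⟩ := hBb hy
      exact (h.zpow_zpow j i).eq
    have haN : a ∈ N := by
      have hmem := mem_zpowers_commutator_of_conj_mem_zpowers hp
        ((Nat.coprime_primes hp hq).2 hpq) ha hbq
        (hAnorm.conj_mem a (Subgroup.mem_zpowers a) b) hne
      refine (Subgroup.zpowers_le.2 ?_) hmem
      obtain ⟨i, rfl⟩ := hc
      have hcomm' : ⁅a ^ i * b, a⁆ ∈ N := by
        simpa only [commutatorElement_def, mul_assoc] using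
          N.mul_mem hxN (hN.conj_mem _ (N.inv_mem hxN) a)
      have h := hN.conj_mem _ hcomm' (a ^ i)⁻¹
      have heq : (a ^ i)⁻¹ * ⁅a ^ i * b, a⁆ * (a ^ i)⁻¹⁻¹ = ⁅b, a⁆ := by
        simp only [commutatorElement_def]
        group
      rwa [heq] at h
    have hbN : b ∈ N := (N.mul_mem_cancel_left ((Subgroup.zpowers_le.2 haN) hc)).1 hxN
    rw [eq_top_iff, ← hjoin]
    exact sup_le (Subgroup.zpowers_le.2 haN) (hBb.trans (Subgroup.zpowers_le.2 hbN))
  by_cases h₁ : N₁ ≤ Subgroup.zpowers a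
  · by_cases h₂ : N₂ ≤ Subgroup.zpowers a
    · by_contra! h
      obtain ⟨x, hx₁, hx₂⟩ := SetLike.not_le_iff_exists.1 h.1
      obtain ⟨y, hy₂, hy₁⟩ := SetLike.not_le_iff_exists.1 h.2
      rcases mem_zpowers_or_mem_zpowers_of_pow_prime_pow_eq_one hp ha (h₁ hx₁) (h₂ hy₂) with h | h
      · exact hx₂ (Subgroup.zpowers_le.2 hy₂ h)
      · exact hy₁ (Subgroup.zpowers_le.2 hx₁ h)
    · exact Or.inl (htop N₂ hN₂ h₂ ▸ le_top)
  · exact Or.inr (htop N₁ hN₁ h₁ ▸ le_top)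
end

section
/- Let p and q be distinct primes and let D be a group that is an internal semidirect product D = A ⋊ B of a cyclic p-group A of order pⁿ (normal in D) and a subgroup B of order q, with [A, B] ≠ 1. Then the union of the D-conjugates of B has cardinality 1 + pⁿ(q − 1). -/
/-- A fixed point other than `1` of an endomorphism of order prime to `p` of a cyclic `p`-group
forces that endomorphism to be trivial. -/
theorem eq_self_of_fixed_of_iterate_eq_self {p q n : ℕ} (hp : p.Prime) (hpq : ¬ p ∣ q)
    {A : Type*} [Group A] [IsCyclic A] (hA : Nat.card A = p ^ n) (σ : A →* A)
    (hσ : ∀ a, σ^[q] a = a) {x : A} (hx : x ≠ 1) (hfix : σ x = x) (a : A) : σ a = a := by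
  obtain ⟨k, hk⟩ := σ.map_cyclic
  have hiter (j : ℕ) (a : A) : σ^[j] a = a ^ (k ^ j) := by
    induction j with
    | zero => simp
    | succ j ih => rw [Function.iterate_succ_apply', ih, hk, ← zpow_mul, pow_succ]
  have hdvd (y : A) (m : ℤ) (h : y ^ m = y) : (orderOf y : ℤ) ∣ m - 1 := by
    rw [orderOf_dvd_iff_zpow_eq_one, zpow_sub_one, h, mul_inv_cancel]
  have hpk : (p : ℤ) ∣ k - 1 := by
    have h1 : orderOf x ∣ p ^ n := hA ▸ orderOf_dvd_natCard x
    obtain ⟨j, -, hj⟩ := (Nat.dvd_prime_pow hp).1 h1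
    have hj0 : j ≠ 0 := by
      rintro rfl
      exact hx (orderOf_eq_one_iff.1 (by simpa using hj))
    have h2 : (p : ℤ) ∣ orderOf x := by
      rw [hj]
      exact_mod_cast dvd_pow_self p hj0
    exact h2.trans (hdvd x k (by rw [← hk, hfix]))
  have hpn : ((p ^ n : ℕ) : ℤ) ∣ k ^ q - 1 := by
    obtain ⟨g, hg⟩ := IsCyclic.exists_generator (α := A)
    rw [← hA, ← orderOf_eq_card_of_forall_mem_zpowers hg]
    exact hdvd g _ (by rw [← hiter, hσ])
  have hcop : IsCoprime ((p ^ n : ℕ) : ℤ) (∑ i ∈ Finset.range q, k ^ i) := by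
    push_cast
    refine IsCoprime.pow_left ?_
    rw [Prime.coprime_iff_not_dvd (Nat.prime_iff_prime_int.1 hp)]
    intro h
    have hsum : (p : ℤ) ∣ (∑ i ∈ Finset.range q, k ^ i) - q := by
      have : (∑ i ∈ Finset.range q, k ^ i) - (q : ℤ) = ∑ i ∈ Finset.range q, (k ^ i - 1) := by
        simp
      rw [this]
      exact Finset.dvd_sum fun i _ => hpk.trans (sub_one_dvd_pow_sub_one k i)
    exact hpq (Int.natCast_dvd_natCast.1 ((dvd_sub_right h).1 hsum))
  rw [← geom_sum_mul] at hpn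
  have hk1 := hcop.dvd_of_dvd_mul_left hpn
  have ha : a ^ (k - 1) = 1 := by
    rw [← orderOf_dvd_iff_zpow_eq_one]
    exact (Int.natCast_dvd_natCast.2 (hA ▸ orderOf_dvd_natCard a)).trans hk1
  rw [hk, ← sub_add_cancel k 1, zpow_add_one, ha, one_mul]

/-- In a nontrivial semidirect product of a cyclic `p`-group `A` by a group `B` of prime order
`q ≠ p`, nontrivial elements of `B` centralize no nontrivial element of `A`. -/
theorem eq_one_of_commute_of_commutator_ne_bot {p q n : ℕ} (hp : p.Prime) (hq : q.Prime)
    (hpq : p ≠ q) {D : Type*} [Group D] {A B : Subgroup D} (hAnorm : A.Normal)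
    (hAcyc : IsCyclic A) (hAcard : Nat.card A = p ^ n) (hBq : Nat.card B = q)
    (hcomm : ⁅A, B⁆ ≠ ⊥) {b c : D} (hb : b ∈ B) (hb1 : b ≠ 1) (hc : c ∈ A)
    (hbc : b * c * b⁻¹ = c) : c = 1 := by
  by_contra hc1
  have hiter (j : ℕ) (a : A) :
      (((MulAut.conjNormal b : MulAut A).toMonoidHom^[j] a : A) : D) = b ^ j * a * (b ^ j)⁻¹ := by
    induction j with
    | zero => simp
    | succ j ih =>
      rw [Function.iterate_succ_apply', MulEquiv.toMonoidHom_eq_coe, MonoidHom.coe_coe,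
        MulAut.conjNormal_apply]
      rw [MulEquiv.toMonoidHom_eq_coe, MonoidHom.coe_coe] at ih
      simp [ih, pow_succ', mul_assoc]
  have hbq : b ^ q = 1 := by
    have := pow_card_eq_one' (x := (⟨b, hb⟩ : B))
    rw [hBq] at this
    exact congrArg Subtype.val this
  have hfix := eq_self_of_fixed_of_iterate_eq_self hp
    (fun h => hpq ((Nat.prime_dvd_prime_iff_eq hp hq).1 h)) hAcard
    (MulAut.conjNormal b : MulAut A).toMonoidHom
    (fun a => Subtype.ext (by rw [hiter, hbq]; simp))
    (x := ⟨c, hc⟩) (fun h => hc1 (congrArg Subtype.val h))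
    (Subtype.ext (by simpa [MulAut.conjNormal_apply] using hbc))
  apply hcomm
  rw [Subgroup.commutator_eq_bot_iff_le_centralizer]
  intro a ha
  rw [Subgroup.mem_centralizer_iff]
  intro y hy
  have hab : Commute b a := by
    have := congrArg Subtype.val (hfix ⟨a, ha⟩)
    simpa [MulAut.conjNormal_apply, mul_inv_eq_iff_eq_mul, commute_iff_eq] using this
  have : Fact q.Prime := ⟨hq⟩
  obtain ⟨m, hm⟩ := Subgroup.mem_zpowers_iff.1 <|
    mem_zpowers_of_prime_card (g := (⟨b, hb⟩ : B)) (g' := ⟨y, hy⟩) hBq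
      (fun h => hb1 (congrArg Subtype.val h))
  have hy' : b ^ m = y := congrArg Subtype.val hm
  exact hy' ▸ hab.zpow_left m

theorem card_union_conjugates_of_B {p q n : ℕ} (hp : p.Prime) (hq : q.Prime)
    (hpq : p ≠ q)
    {D : Type*} [Group D] (A B : Subgroup D) (hAnorm : A.Normal)
    (hAcyc : IsCyclic A) (hAcard : Nat.card A = p ^ n) (hBq : Nat.card B = q)
    (hint : A ⊓ B = ⊥) (hjoin : A ⊔ B = ⊤) (hcomm : ⁅A, B⁆ ≠ ⊥) :
    Nat.card (⋃ g : D, (fun x => g * x * g⁻¹) '' (B : Set D)) =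
      1 + p ^ n * (q - 1) := by
  have : Finite A := Nat.finite_of_card_ne_zero (by rw [hAcard]; exact pow_ne_zero _ hp.ne_zero)
  have : Finite B := Nat.finite_of_card_ne_zero (by rw [hBq]; exact hq.ne_zero)
  let f : A × {b : B // b ≠ 1} → D := fun x => x.1 * x.2.1 * (x.1 : D)⁻¹
  have hf : Function.Injective f := by
    rintro ⟨⟨a, ha⟩, ⟨⟨b, hb⟩, hb1⟩⟩ ⟨⟨a', ha'⟩, ⟨⟨b', hb'⟩, hb1'⟩⟩ h
    replace h : a * b * a⁻¹ = a' * b' * a'⁻¹ := h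
    have hc : a'⁻¹ * a ∈ A := A.mul_mem (A.inv_mem ha') ha
    have hconj : (a'⁻¹ * a) * b * (a'⁻¹ * a)⁻¹ = b' := by
      calc _ = a'⁻¹ * (a * b * a⁻¹) * a' := by group
        _ = b' := by rw [h]; group
    have hbb : b' * b⁻¹ ∈ A ⊓ B := by
      refine ⟨?_, B.mul_mem hb' (B.inv_mem hb)⟩
      have := A.mul_mem hc (hAnorm.conj_mem _ (A.inv_mem hc) b)
      rw [← hconj]
      simpa [mul_assoc] using this
    rw [hint, Subgroup.mem_bot, mul_inv_eq_one] at hbb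
    subst hbb
    have hone := eq_one_of_commute_of_commutator_ne_bot hp hq hpq hAnorm hAcyc hAcard hBq hcomm
      hb (fun h => hb1 (Subtype.ext h)) hc
      (by rw [mul_inv_eq_iff_eq_mul] at hconj ⊢; exact hconj.symm)
    obtain rfl := inv_mul_eq_one.1 hone
    rfl
  have hunion : (⋃ g : D, (fun x => g * x * g⁻¹) '' (B : Set D)) = insert 1 (Set.range f) := by
    ext y
    simp only [Set.mem_iUnion, Set.mem_image, Set.mem_insert_iff, Set.mem_range, SetLike.mem_coe]
    constructor
    · rintro ⟨g, x, hx, rfl⟩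
      by_cases hx1 : x = 1
      · simp [hx1]
      obtain ⟨a, ha, b, hb, rfl⟩ := Subgroup.mem_sup_of_normal_left.1 (hjoin ▸ Subgroup.mem_top g)
      refine .inr ⟨⟨⟨a, ha⟩, ⟨⟨b * x * b⁻¹, B.mul_mem (B.mul_mem hb hx) (B.inv_mem hb)⟩, ?_⟩⟩, ?_⟩
      · intro h
        exact hx1 (conj_eq_one_iff.1 (congrArg Subtype.val h))
      · simp [f, mul_assoc]
    · rintro (rfl | ⟨⟨a, b⟩, rfl⟩)
      · exact ⟨1, 1, B.one_mem, by simp⟩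
      · exact ⟨a, b.1, b.1.2, rfl⟩
  have hnotMem : (1 : D) ∉ Set.range f := by
    rintro ⟨⟨a, b⟩, h⟩
    exact b.2 (Subtype.ext (conj_eq_one_iff.1 h))
  have hcardB : Nat.card {b : B // b ≠ 1} = q - 1 := by
    have h := Set.ncard_compl ({1} : Set B)
    rw [Set.ncard_singleton, hBq] at h
    exact h
  rw [hunion, Nat.card_coe_set_eq, Set.ncard_insert_of_notMem hnotMem (Set.finite_range f),
    ← Nat.card_coe_set_eq, Nat.card_range_of_injective hf, Nat.card_prod, hAcard, hcardB, add_comm]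
end

section
/- Let G be a locally finite group and H a normal subgroup of G such that the quotient G/H is finitely generated. Then there exists a finite subgroup K of G such that K/(K ∩ H) is isomorphic to G/H. -/
/-- A finitely generated subgroup of the codomain of a surjective homomorphism is the image of a
finitely generated subgroup of the domain. -/
theorem Subgroup.FG.exists_map_eq_of_surjective {G G' : Type*} [Group G] [Group G'] {f : G →* G'}
    (hf : Function.Surjective f) {P : Subgroup G'} (hP : P.FG) :
    ∃ K : Subgroup G, K.FG ∧ K.map f = P := by
  obtain ⟨S, hS, hfin⟩ := (Subgroup.fg_iff P).1 hP
  refine ⟨Subgroup.closure (Function.surjInv hf '' S),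
    (Subgroup.fg_iff _).2 ⟨_, rfl, hfin.image _⟩, ?_⟩
  rw [MonoidHom.map_closure, Set.image_image]
  simp only [Function.surjInv_eq, Set.image_id', hS]

theorem finite_subgroup_covering_fg_quotient {G : Type*} [Group G]
    (hG : IsLocallyFinite G) (H : Subgroup G) [H.Normal]
    (hfg : Group.FG (G ⧸ H)) :
    ∃ K : Subgroup G, Finite K ∧ Nonempty ((K ⧸ H.subgroupOf K) ≃* (G ⧸ H)) := by
  obtain ⟨K, hK, hmap⟩ := (Group.fg_def.1 hfg).exists_map_eq_of_surjective
    (QuotientGroup.mk'_surjective H)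
  let f : K →* G ⧸ H := (QuotientGroup.mk' H).comp K.subtype
  have hsurj : Function.Surjective f := by
    rw [← MonoidHom.range_eq_top, MonoidHom.range_comp, K.range_subtype, hmap]
  have hker : f.ker = H.subgroupOf K := by
    rw [← MonoidHom.comap_ker, QuotientGroup.ker_mk', Subgroup.subgroupOf]
  exact ⟨K, hG K hK, ⟨(QuotientGroup.quotientMulEquivOfEq hker.symm).trans
    (QuotientGroup.quotientKerEquivOfSurjective f hsurj)⟩⟩
end

section
/- Let p be a prime, P a finite p-group, H a normal subgroup of P of order p^k with P/H cyclic of order pⁿ, n ≥ 1, and let Nᵢ (for i = 0, …, k) denote the number of cyclic subgroups T of P of order p^{n+i} satisfying HT = P. Then p^{n+k−1} = Σ_{i=0}^{k} Nᵢ · p^{n+i−1}. In particular, for any prime q ≠ p, there exists an index j ∈ {0, …, k} such that q does not divide N_j. -/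
/-- A cyclic subgroup `T` of a finite group has `φ(|T|)` generators. -/
theorem Subgroup.card_zpowers_eq {G : Type*} [Group G] [Finite G] (T : Subgroup G) [IsCyclic T] :
    Nat.card {x : G // Subgroup.zpowers x = T} = (Nat.card T).totient := by
  classical
  have := Fintype.ofFinite T
  have e : {x : G // Subgroup.zpowers x = T} ≃ {y : T // orderOf y = Nat.card T} :=
    { toFun := fun x => ⟨⟨x.1, x.2.le (Subgroup.mem_zpowers x.1)⟩, by
        rw [Subgroup.orderOf_mk, ← Nat.card_zpowers, x.2]⟩
      invFun := fun y => ⟨y.1, Subgroup.eq_of_le_of_card_ge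
        (Subgroup.zpowers_le.2 y.1.2) (by
          rw [Nat.card_zpowers, Subgroup.orderOf_coe, y.2])⟩
      left_inv := fun _ => rfl
      right_inv := fun _ => rfl }
  rw [Nat.card_congr e, Nat.card_eq_fintype_card, Fintype.card_subtype]
  rw [Nat.card_eq_fintype_card]
  exact IsCyclic.card_orderOf_eq_totient dvd_rfl

theorem Subgroup.sup_eq_top_iff_map_mk' {G : Type*} [Group G] (H T : Subgroup G) [H.Normal] :
    H ⊔ T = ⊤ ↔ T.map (QuotientGroup.mk' H) = ⊤ := by
  have h : (T.map (QuotientGroup.mk' H)).comap (QuotientGroup.mk' H) = H ⊔ T := by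
    rw [Subgroup.comap_map_eq, QuotientGroup.ker_mk', sup_comm]
  rw [← h, ← Subgroup.comap_top (QuotientGroup.mk' H),
    (Subgroup.comap_injective (QuotientGroup.mk'_surjective H)).eq_iff]

/-- The number of elements of `G` whose image generates the cyclic quotient `G ⧸ H`. -/
theorem Subgroup.card_sup_zpowers_eq_top {G : Type*} [Group G] [Finite G] (H : Subgroup G)
    [H.Normal] [IsCyclic (G ⧸ H)] :
    Nat.card {x : G // H ⊔ Subgroup.zpowers x = ⊤} =
      Nat.card H * (Nat.card (G ⧸ H)).totient := by
  have : IsCyclic (⊤ : Subgroup (G ⧸ H)) := Subgroup.isCyclic _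
  have e := QuotientGroup.preimageMkEquivSubgroupProdSet H
    {y : G ⧸ H | Subgroup.zpowers y = ⊤}
  have h := Subgroup.card_zpowers_eq (⊤ : Subgroup (G ⧸ H))
  rw [Subgroup.card_top] at h
  rw [← h, ← Nat.card_prod]
  refine Nat.card_congr ((Equiv.subtypeEquivRight fun x => ?_).trans e)
  simp [Subgroup.sup_eq_top_iff_map_mk', MonoidHom.map_zpowers]

/-- The cyclic supplements of `H`, weighted by their numbers of generators, count the elements
whose image generates the cyclic quotient. -/
theorem Subgroup.sum_totient_card_cyclic_supplements {G : Type*} [Group G] [Finite G]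
    (H : Subgroup G) [H.Normal] [IsCyclic (G ⧸ H)]
    [Fintype {T : Subgroup G // IsCyclic T ∧ H ⊔ T = ⊤}] :
    ∑ T : {T : Subgroup G // IsCyclic T ∧ H ⊔ T = ⊤}, (Nat.card T.1).totient =
      Nat.card H * (Nat.card (G ⧸ H)).totient := by
  have e : {x : G // H ⊔ Subgroup.zpowers x = ⊤} ≃
      Σ T : {T : Subgroup G // IsCyclic T ∧ H ⊔ T = ⊤}, {x : G // Subgroup.zpowers x = T.1} :=
    { toFun := fun x => ⟨⟨Subgroup.zpowers x.1, inferInstance, x.2⟩, x.1, rfl⟩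
      invFun := fun y => ⟨y.2.1, y.2.2.symm ▸ y.1.2.2⟩
      left_inv := fun _ => rfl
      right_inv := by
        rintro ⟨⟨T, hT⟩, x, hx⟩
        obtain rfl : Subgroup.zpowers x = T := hx
        rfl }
  rw [← Subgroup.card_sup_zpowers_eq_top, Nat.card_congr e, Nat.card_sigma]
  refine Finset.sum_congr rfl fun T _ => ?_
  have := T.2.1
  exact (Subgroup.card_zpowers_eq T.1).symm

theorem Subgroup.exists_card_supplement_eq {p n k : ℕ} (hp : p.Prime) {P : Type*} [Group P]
    [Finite P] (H : Subgroup P) [H.Normal] (hHcard : Nat.card H = p ^ k)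
    (hcard : Nat.card (P ⧸ H) = p ^ n) {T : Subgroup P} (hT : H ⊔ T = ⊤) :
    ∃ i ≤ k, Nat.card T = p ^ (n + i) := by
  have hdvd : Nat.card T ∣ p ^ (n + k) := by
    rw [pow_add, ← hcard, ← hHcard, ← Subgroup.card_eq_card_quotient_mul_card_subgroup]
    exact Subgroup.card_subgroup_dvd_card T
  obtain ⟨m, hm, hTm⟩ := (Nat.dvd_prime_pow hp).1 hdvd
  have hle : p ^ n ∣ p ^ m := by
    rw [← hTm, ← hcard, ← Subgroup.card_top (G := P ⧸ H),
      ← (Subgroup.sup_eq_top_iff_map_mk' H T).1 hT]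
    exact Subgroup.card_map_dvd T _
  have hnm := (Nat.pow_dvd_pow_iff_le_right hp.one_lt).1 hle
  exact ⟨m - n, by omega, by rw [hTm, Nat.add_sub_cancel' hnm]⟩

theorem counting_cyclic_supplements {p n k : ℕ} (hp : p.Prime)
    {P : Type*} [Group P] [Finite P] (hPp : IsPGroup p P)
    (H : Subgroup P) [H.Normal] (hHcard : Nat.card H = p ^ k)
    (hcyc : IsCyclic (P ⧸ H)) (hcard : Nat.card (P ⧸ H) = p ^ n) (hn : 1 ≤ n)
    (N : ℕ → ℕ)
    (hN : ∀ i, N i = Nat.card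
      {T : Subgroup P // IsCyclic T ∧ Nat.card T = p ^ (n + i) ∧ H ⊔ T = ⊤}) :
    p ^ (n + k - 1) = ∑ i ∈ Finset.range (k + 1), N i * p ^ (n + i - 1) ∧
      ∀ q : ℕ, q.Prime → q ≠ p → ∃ j ≤ k, ¬ q ∣ N j := by
  classical
  have hsum : p ^ (n + k - 1) = ∑ i ∈ Finset.range (k + 1), N i * p ^ (n + i - 1) := by
    have := Fintype.ofFinite {T : Subgroup P // IsCyclic T ∧ H ⊔ T = ⊤}
    have h := Subgroup.sum_totient_card_cyclic_supplements H
    have hT (T : {T : Subgroup P // IsCyclic T ∧ H ⊔ T = ⊤}) :=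
      Subgroup.exists_card_supplement_eq hp H hHcard hcard T.2.2
    choose i hik hi using hT
    rw [← Finset.sum_fiberwise_of_maps_to (t := Finset.range (k + 1)) (g := i)
      fun T _ => Finset.mem_range_succ_iff.2 (hik T)] at h
    have hfiber (j : ℕ) : ∑ T with i T = j, (Nat.card T.1).totient =
        N j * p ^ (n + j - 1) * (p - 1) := by
      have e : {T : {T : Subgroup P // IsCyclic T ∧ H ⊔ T = ⊤} // i T = j} ≃
          {T : Subgroup P // IsCyclic T ∧ Nat.card T = p ^ (n + j) ∧ H ⊔ T = ⊤} :=
        { toFun := fun T => ⟨T.1.1, T.1.2.1, by rw [hi T.1, T.2], T.1.2.2⟩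
          invFun := fun T => ⟨⟨T.1, T.2.1, T.2.2.2⟩, Nat.add_left_cancel
            (Nat.pow_right_injective hp.two_le ((hi _).symm.trans T.2.2.1))⟩
          left_inv := fun _ => rfl
          right_inv := fun _ => rfl }
      rw [hN, ← Nat.card_congr e, Nat.card_eq_fintype_card, Fintype.card_subtype, mul_assoc,
        ← Nat.totient_prime_pow hp (by omega), ← smul_eq_mul]
      refine Finset.sum_eq_card_nsmul fun T hT => ?_
      rw [hi T, (Finset.mem_filter.1 hT).2]
    simp_rw [hfiber] at h
    rw [← Finset.sum_mul, hHcard, hcard, Nat.totient_prime_pow hp hn, ← mul_assoc,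
      ← pow_add] at h
    rw [Nat.eq_of_mul_eq_mul_right (Nat.sub_pos_of_lt hp.one_lt) h]
    congr 1
    omega
  refine ⟨hsum, fun q hq hqp => ?_⟩
  by_contra! hdvd
  refine hqp ((Nat.prime_dvd_prime_iff_eq hq hp).1 (hq.dvd_of_dvd_pow (n := n + k - 1) ?_))
  rw [hsum]
  exact Finset.dvd_sum fun j hj =>
    (hdvd j (Finset.mem_range_succ_iff.1 hj)).mul_right _
end
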